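/- Let (A, B) be a finitely supported random variable taking values in G × G for an abelian group G, and set Z := A + B. Then Σ_z p_Z(z)·d[(A | Z = z); (B | Z = z)] ≤ 3·I[A : B] + 2·H[Z] − H[A] − H[B]. -/

import Mathlib

open scoped Classical BigOperators Pointwise
open Finset

noncomputable section

/-- The probability that the random variable `X` equals `s`, under the pmf `μ`. -/
def pmass {Ω S : Type*} [Fintype Ω] (μ : Ω → ℝ) (X : Ω → S) (s : S) : ℝ :=
  ∑ ω, if X ω = s then μ ω else 0

/-- `μ` is a probability mass function on the finite type `Ω`. -/
def IsProb {Ω : Type*} [Fintype Ω] (μ : Ω → ℝ) : Prop :=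
  (∀ ω, 0 ≤ μ ω) ∧ ∑ ω, μ ω = 1

/-- Shannon entropy `H[X]` of a random variable `X : Ω → S` under `μ`. -/
def ent {Ω S : Type*} [Fintype Ω] (μ : Ω → ℝ) (X : Ω → S) : ℝ :=
  ∑ s ∈ Finset.univ.image X, Real.negMulLog (pmass μ X s)

/-- Mutual information `I[X : Y]`. -/
def mutualInfo {Ω S T : Type*} [Fintype Ω] (μ : Ω → ℝ) (X : Ω → S) (Y : Ω → T) : ℝ :=
  ent μ X + ent μ Y - ent μ (fun ω => (X ω, Y ω))

/-- The conditional measure, conditioning on the event `Y = y`. -/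
def condMeas {Ω T : Type*} [Fintype Ω] (μ : Ω → ℝ) (Y : Ω → T) (y : T) : Ω → ℝ :=
  fun ω => if Y ω = y then μ ω / pmass μ Y y else 0

/-- Conditional mutual information `I[X : Y | Z]`. -/
def condMutualInfo {Ω S T U : Type*} [Fintype Ω] (μ : Ω → ℝ)
    (X : Ω → S) (Y : Ω → T) (Z : Ω → U) : ℝ :=
  ∑ z ∈ Finset.univ.image Z, pmass μ Z z * mutualInfo (condMeas μ Z z) X Y

/-- Entropic Ruzsa distance `d[X ; Y]`, defined via independent copies on a product space. -/
def rdist {Ω₁ Ω₂ G : Type*} [Fintype Ω₁] [Fintype Ω₂] [AddCommGroup G]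
    (μ₁ : Ω₁ → ℝ) (X : Ω₁ → G) (μ₂ : Ω₂ → ℝ) (Y : Ω₂ → G) : ℝ :=
  ent (fun p : Ω₁ × Ω₂ => μ₁ p.1 * μ₂ p.2) (fun p => X p.1 - Y p.2)
    - ent μ₁ X / 2 - ent μ₂ Y / 2

/-- Conditional Ruzsa distance `d[X | Z ; Y | W]`. -/
def condRdist {Ω₁ Ω₂ G T U : Type*} [Fintype Ω₁] [Fintype Ω₂] [AddCommGroup G]
    (μ₁ : Ω₁ → ℝ) (X : Ω₁ → G) (Z : Ω₁ → T)
    (μ₂ : Ω₂ → ℝ) (Y : Ω₂ → G) (W : Ω₂ → U) : ℝ :=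
  ∑ z ∈ Finset.univ.image Z, ∑ w ∈ Finset.univ.image W,
    pmass μ₁ Z z * pmass μ₂ W w * rdist (condMeas μ₁ Z z) X (condMeas μ₂ W w) Y

/-- Conditional Ruzsa distance `d[X ; Y | W]`, conditioning only on the right variable. -/
def condRdistRight {Ω₁ Ω₂ G U : Type*} [Fintype Ω₁] [Fintype Ω₂] [AddCommGroup G]
    (μ₁ : Ω₁ → ℝ) (X : Ω₁ → G)
    (μ₂ : Ω₂ → ℝ) (Y : Ω₂ → G) (W : Ω₂ → U) : ℝ :=
  ∑ w ∈ Finset.univ.image W, pmass μ₂ W w * rdist μ₁ X (condMeas μ₂ W w) Y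

/-- The uniform probability mass function on a subset `H` of a finite type. -/
def unifOn {G : Type*} [Fintype G] (H : Set G) : G → ℝ :=
  fun g => if g ∈ H then ((Nat.card H : ℝ))⁻¹ else 0

/-- `X` (under `μ₁`) and `Y` (under `μ₂`) are identically distributed. -/
def IdentDist {Ω₁ Ω₂ S : Type*} [Fintype Ω₁] [Fintype Ω₂]
    (μ₁ : Ω₁ → ℝ) (X : Ω₁ → S) (μ₂ : Ω₂ → ℝ) (Y : Ω₂ → S) : Prop :=
  ∀ s, pmass μ₁ X s = pmass μ₂ Y s

/-- Two random variables are independent. -/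
def IndepPair {Ω S T : Type*} [Fintype Ω] (μ : Ω → ℝ) (X : Ω → S) (Y : Ω → T) : Prop :=
  ∀ s t, pmass μ (fun ω => (X ω, Y ω)) (s, t) = pmass μ X s * pmass μ Y t

/-- Three random variables are jointly independent. -/
def IndepTriple {Ω S T U : Type*} [Fintype Ω] (μ : Ω → ℝ)
    (X : Ω → S) (Y : Ω → T) (Z : Ω → U) : Prop :=
  ∀ s t u, pmass μ (fun ω => (X ω, Y ω, Z ω)) (s, t, u)
    = pmass μ X s * pmass μ Y t * pmass μ Z u

/-- Four random variables are jointly independent. -/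
def IndepFour {Ω S T U V : Type*} [Fintype Ω] (μ : Ω → ℝ)
    (X : Ω → S) (Y : Ω → T) (Z : Ω → U) (W : Ω → V) : Prop :=
  ∀ s t u v, pmass μ (fun ω => (X ω, Y ω, Z ω, W ω)) (s, t, u, v)
    = pmass μ X s * pmass μ Y t * pmass μ Z u * pmass μ W v


lemma pmass_nonneg' {Ω S : Type*} [Fintype Ω] {μ : Ω → ℝ} (h : ∀ ω, 0 ≤ μ ω) (X : Ω → S) (s : S) :
    0 ≤ pmass μ X s := by
  unfold pmass
  exact Finset.sum_nonneg fun ω _ => by split_ifs; exacts [h ω, le_rfl]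

lemma le_pmass {Ω S : Type*} [Fintype Ω] {μ : Ω → ℝ} (h : ∀ ω, 0 ≤ μ ω) (X : Ω → S) (ω : Ω) :
    μ ω ≤ pmass μ X (X ω) := by
  unfold pmass
  have := Finset.single_le_sum (f := fun ω' => if X ω' = X ω then μ ω' else 0)
    (fun ω' _ => by split_ifs; exacts [h ω', le_rfl]) (Finset.mem_univ ω)
  simpa using this

lemma sum_fiber {Ω S : Type*} [Fintype Ω] (μ : Ω → ℝ) (X : Ω → S) (f : S → ℝ) :
    ∑ s ∈ Finset.univ.image X, pmass μ X s * f s = ∑ ω, μ ω * f (X ω) := by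
  simp only [pmass, Finset.sum_mul]
  rw [Finset.sum_comm]
  refine Finset.sum_congr rfl fun ω _ => ?_
  simp [ite_mul, Finset.sum_ite_eq]

lemma ent_eq {Ω S : Type*} [Fintype Ω] (μ : Ω → ℝ) (X : Ω → S) :
    ent μ X = - ∑ ω, μ ω * Real.log (pmass μ X (X ω)) := by
  rw [← sum_fiber μ X (fun s => Real.log (pmass μ X s)), ← Finset.sum_neg_distrib]
  unfold ent
  refine Finset.sum_congr rfl fun s _ => ?_
  simp [Real.negMulLog]

lemma ent_congr {Ω S T : Type*} [Fintype Ω] (μ : Ω → ℝ) (X : Ω → S) (Y : Ω → T)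
    (h : ∀ ω ω', μ ω ≠ 0 → μ ω' ≠ 0 → (X ω = X ω' ↔ Y ω = Y ω')) : ent μ X = ent μ Y := by
  rw [ent_eq, ent_eq]
  congr 1
  refine Finset.sum_congr rfl fun ω _ => ?_
  by_cases h0 : μ ω = 0
  · simp [h0]
  congr 2
  unfold pmass
  refine Finset.sum_congr rfl fun ω' _ => ?_
  by_cases h1 : μ ω' = 0
  · simp [h1]
  simp only [h ω' ω h1 h0]

lemma sum_pair_left {Ω S T : Type*} [Fintype Ω] (μ : Ω → ℝ) (X : Ω → S) (Z : Ω → T) (z : T) :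
    ∑ x ∈ Finset.univ.image X, pmass μ (fun ω => (X ω, Z ω)) (x, z) = pmass μ Z z := by
  unfold pmass
  rw [Finset.sum_comm]
  refine Finset.sum_congr rfl fun ω _ => ?_
  by_cases hz : Z ω = z
  · simp [hz, Finset.sum_ite_eq]
  · simp [hz]

lemma sum_pmass {Ω S : Type*} [Fintype Ω] (μ : Ω → ℝ) (X : Ω → S) :
    ∑ x ∈ Finset.univ.image X, pmass μ X x = ∑ ω, μ ω := by
  simpa using sum_fiber μ X (fun _ => 1)

lemma submod {Ω S T U : Type*} [Fintype Ω] (μ : Ω → ℝ) (hμ : IsProb μ)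
    (X : Ω → S) (Y : Ω → T) (Z : Ω → U) :
    ent μ (fun ω => (X ω, Y ω, Z ω)) + ent μ Z
      ≤ ent μ (fun ω => (X ω, Z ω)) + ent μ (fun ω => (Y ω, Z ω)) := by
  obtain ⟨h0, h1⟩ := hμ
  set W : Ω → S × T × U := fun ω => (X ω, Y ω, Z ω) with hW
  set XZ : Ω → S × U := fun ω => (X ω, Z ω) with hXZ
  set YZ : Ω → T × U := fun ω => (Y ω, Z ω) with hYZ
  let g : S × T × U → ℝ := fun w =>
    pmass μ XZ (w.1, w.2.2) * pmass μ YZ (w.2.1, w.2.2) / (pmass μ W w * pmass μ Z w.2.2)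
  have key : ∑ ω, μ ω * g (W ω) ≤ 1 := by
    rw [← sum_fiber]
    refine le_trans (le_of_eq (by congr!)) (?_ : ∑ w ∈ Finset.univ.image W, pmass μ W w * g w ≤ 1)
    calc ∑ w ∈ Finset.univ.image W, pmass μ W w * g w
        ≤ ∑ w ∈ Finset.univ.image W,
            pmass μ XZ (w.1, w.2.2) * pmass μ YZ (w.2.1, w.2.2) / pmass μ Z w.2.2 := by
          refine Finset.sum_le_sum fun w _ => ?_
          by_cases hw : pmass μ W w = 0
          · rw [hw, zero_mul]
            exact div_nonneg (mul_nonneg (pmass_nonneg' h0 _ _) (pmass_nonneg' h0 _ _))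
              (pmass_nonneg' h0 _ _)
          · refine le_of_eq ?_
            simp only [g]
            rw [← div_div, div_right_comm, mul_div_cancel₀ _ hw]
      _ ≤ ∑ w ∈ (Finset.univ.image X) ×ˢ (Finset.univ.image Y) ×ˢ (Finset.univ.image Z),
            pmass μ XZ (w.1, w.2.2) * pmass μ YZ (w.2.1, w.2.2) / pmass μ Z w.2.2 := by
          refine Finset.sum_le_sum_of_subset_of_nonneg ?_ ?_
          · intro w hw
            obtain ⟨ω, -, rfl⟩ := Finset.mem_image.1 hw
            simp [hW]
          · intro w _ _
            exact div_nonneg (mul_nonneg (pmass_nonneg' h0 _ _) (pmass_nonneg' h0 _ _))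
              (pmass_nonneg' h0 _ _)
      _ = ∑ z ∈ Finset.univ.image Z, pmass μ Z z := by
          rw [Finset.sum_product]
          simp only [Finset.sum_product_right]
          rw [Finset.sum_comm]
          refine Finset.sum_congr rfl fun z _ => ?_
          simp only [← Finset.sum_div, ← Finset.mul_sum, ← Finset.sum_mul]
          rw [sum_pair_left, sum_pair_left]
          by_cases hz : pmass μ Z z = 0
          · simp [hz]
          · field_simp
      _ = 1 := by rw [sum_pmass, h1]
  have key2 : ∑ ω, μ ω * (Real.log (pmass μ XZ (XZ ω)) + Real.log (pmass μ YZ (YZ ω))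
      - Real.log (pmass μ W (W ω)) - Real.log (pmass μ Z (Z ω))) ≤ ∑ ω, μ ω * (g (W ω) - 1) := by
    refine Finset.sum_le_sum fun ω _ => ?_
    by_cases hω : μ ω = 0
    · simp [hω]
    have hp : 0 < μ ω := lt_of_le_of_ne (h0 ω) (Ne.symm hω)
    have a1 := lt_of_lt_of_le hp (le_pmass h0 XZ ω)
    have a2 := lt_of_lt_of_le hp (le_pmass h0 YZ ω)
    have a3 := lt_of_lt_of_le hp (le_pmass h0 W ω)
    have a4 := lt_of_lt_of_le hp (le_pmass h0 Z ω)
    refine mul_le_mul_of_nonneg_left ?_ hp.le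
    have hg : g (W ω) = pmass μ XZ (XZ ω) * pmass μ YZ (YZ ω) /
      (pmass μ W (W ω) * pmass μ Z (Z ω)) := rfl
    have hpos : 0 < g (W ω) := by rw [hg]; positivity
    have := Real.log_le_sub_one_of_pos hpos
    rw [hg, Real.log_div (by positivity) (by positivity), Real.log_mul a1.ne' a2.ne',
      Real.log_mul a3.ne' a4.ne', ← hg] at this
    linarith
  simp only [mul_sub, mul_add, Finset.sum_sub_distrib, Finset.sum_add_distrib, mul_one, h1] at key2
  rw [ent_eq, ent_eq, ent_eq, ent_eq]
  linarith

lemma ent_const {Ω : Type*} [Fintype Ω] (μ : Ω → ℝ) (hμ : IsProb μ) :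
    ent μ (fun _ : Ω => ()) = 0 := by
  rw [ent_eq]
  simp [pmass, hμ.2]

lemma subadd {Ω S T : Type*} [Fintype Ω] (μ : Ω → ℝ) (hμ : IsProb μ)
    (X : Ω → S) (Y : Ω → T) :
    ent μ (fun ω => (X ω, Y ω)) ≤ ent μ X + ent μ Y := by
  have h := submod μ hμ X Y (fun _ => ())
  rw [ent_const μ hμ, ent_congr μ (fun ω => (X ω, Y ω, ())) (fun ω => (X ω, Y ω)) (by simp),
    ent_congr μ (fun ω => (X ω, ())) X (by simp),
    ent_congr μ (fun ω => (Y ω, ())) Y (by simp)] at h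
  linarith

lemma chain {Ω S T : Type*} [Fintype Ω] (μ : Ω → ℝ) (h0 : ∀ ω, 0 ≤ μ ω)
    (X : Ω → S) (Z : Ω → T) :
    ∑ z ∈ Finset.univ.image Z, pmass μ Z z * ent (condMeas μ Z z) X
      = ent μ (fun ω => (X ω, Z ω)) - ent μ Z := by
  have hc : ∀ x z, pmass (condMeas μ Z z) X x
      = pmass μ (fun ω => (X ω, Z ω)) (x, z) / pmass μ Z z := by
    intro x z
    rw [pmass, pmass, Finset.sum_div]
    refine Finset.sum_congr rfl fun ω _ => ?_
    by_cases h1 : X ω = x <;> by_cases h2 : Z ω = z <;> simp [condMeas, h1, h2]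
  have : ∀ z ∈ Finset.univ.image Z, pmass μ Z z * ent (condMeas μ Z z) X =
      ∑ ω, if Z ω = z then - (μ ω * (Real.log (pmass μ (fun ω => (X ω, Z ω)) (X ω, Z ω))
        - Real.log (pmass μ Z (Z ω)))) else 0 := by
    intro z _
    rw [ent_eq, ← Finset.sum_neg_distrib, Finset.mul_sum]
    refine Finset.sum_congr rfl fun ω _ => ?_
    rw [hc]
    by_cases hz : Z ω = z
    · subst hz
      by_cases hω : μ ω = 0
      · simp [hω, condMeas]
      have hp : 0 < μ ω := lt_of_le_of_ne (h0 ω) (Ne.symm hω)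
      have a1 := lt_of_lt_of_le hp (le_pmass h0 (fun ω => (X ω, Z ω)) ω)
      have a4 := lt_of_lt_of_le hp (le_pmass h0 Z ω)
      rw [Real.log_div a1.ne' a4.ne']
      simp only [condMeas, if_true]
      field_simp
    · simp [hz, condMeas]
  rw [Finset.sum_congr rfl this, Finset.sum_comm]
  rw [ent_eq, ent_eq, ← Finset.sum_neg_distrib, ← Finset.sum_neg_distrib, ← Finset.sum_sub_distrib]
  refine Finset.sum_congr rfl fun ω _ => ?_
  rw [Finset.sum_ite_eq]
  simp
  ring

/-- Conditionally independent copies relative to `Z`. -/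
def cprod {Ω T : Type*} [Fintype Ω] (μ : Ω → ℝ) (Z : Ω → T) : Ω × Ω → ℝ :=
  fun p => if Z p.1 = Z p.2 then μ p.1 * μ p.2 / pmass μ Z (Z p.1) else 0

lemma cprod_nonneg {Ω T : Type*} [Fintype Ω] {μ : Ω → ℝ} (h0 : ∀ ω, 0 ≤ μ ω) (Z : Ω → T) :
    ∀ p, 0 ≤ cprod μ Z p := by
  intro p
  unfold cprod
  split_ifs
  · exact div_nonneg (mul_nonneg (h0 _) (h0 _)) (pmass_nonneg' h0 _ _)
  · exact le_rfl

lemma cprod_swap {Ω T : Type*} [Fintype Ω] (μ : Ω → ℝ) (Z : Ω → T) (a b : Ω) :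
    cprod μ Z (a, b) = cprod μ Z (b, a) := by
  unfold cprod
  by_cases h : Z a = Z b
  · simp [h, mul_comm]
  · simp [h, Ne.symm h]

lemma cprod_fst {Ω T : Type*} [Fintype Ω] {μ : Ω → ℝ} (h0 : ∀ ω, 0 ≤ μ ω) (Z : Ω → T)
    (f : Ω → ℝ) : ∑ p, cprod μ Z p * f p.1 = ∑ ω, μ ω * f ω := by
  rw [Fintype.sum_prod_type]
  refine Finset.sum_congr rfl fun a _ => ?_
  dsimp only
  rw [← Finset.sum_mul]
  congr 1
  have : ∀ b, cprod μ Z (a, b) = μ a / pmass μ Z (Z a) * (if Z b = Z a then μ b else 0) := by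
    intro b
    unfold cprod
    by_cases h : Z a = Z b
    · simp [h]; ring
    · simp [h, Ne.symm h]
  simp only [this]
  rw [← Finset.mul_sum]
  change μ a / pmass μ Z (Z a) * pmass μ Z (Z a) = μ a
  by_cases hz : pmass μ Z (Z a) = 0
  · have := le_pmass h0 Z a
    rw [hz] at this ⊢
    simp [le_antisymm this (h0 a)]
  · exact div_mul_cancel₀ _ hz

lemma cprod_snd {Ω T : Type*} [Fintype Ω] {μ : Ω → ℝ} (h0 : ∀ ω, 0 ≤ μ ω) (Z : Ω → T)
    (f : Ω → ℝ) : ∑ p, cprod μ Z p * f p.2 = ∑ ω, μ ω * f ω := by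
  rw [← cprod_fst h0 Z f, Fintype.sum_prod_type, Fintype.sum_prod_type, Finset.sum_comm]
  refine Finset.sum_congr rfl fun a _ => Finset.sum_congr rfl fun b _ => ?_
  rw [cprod_swap]

lemma cprod_prob {Ω T : Type*} [Fintype Ω] {μ : Ω → ℝ} (h : IsProb μ) (Z : Ω → T) :
    IsProb (cprod μ Z) := by
  refine ⟨cprod_nonneg h.1 Z, ?_⟩
  simpa [h.2] using cprod_fst h.1 Z (fun _ => 1)

lemma cprod_pmass_fst {Ω S T : Type*} [Fintype Ω] {μ : Ω → ℝ} (h0 : ∀ ω, 0 ≤ μ ω) (Z : Ω → T)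
    (X : Ω → S) (s : S) : pmass (cprod μ Z) (fun p => X p.1) s = pmass μ X s := by
  simpa [pmass] using cprod_fst h0 Z (fun ω => if X ω = s then 1 else 0)

lemma cprod_pmass_snd {Ω S T : Type*} [Fintype Ω] {μ : Ω → ℝ} (h0 : ∀ ω, 0 ≤ μ ω) (Z : Ω → T)
    (X : Ω → S) (s : S) : pmass (cprod μ Z) (fun p => X p.2) s = pmass μ X s := by
  simpa [pmass] using cprod_snd h0 Z (fun ω => if X ω = s then 1 else 0)

lemma cprod_ent_fst {Ω S T : Type*} [Fintype Ω] {μ : Ω → ℝ} (h0 : ∀ ω, 0 ≤ μ ω) (Z : Ω → T)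
    (X : Ω → S) : ent (cprod μ Z) (fun p => X p.1) = ent μ X := by
  rw [ent_eq, ent_eq, ← cprod_fst h0 Z]
  simp only [cprod_pmass_fst h0]

lemma cprod_ent_snd {Ω S T : Type*} [Fintype Ω] {μ : Ω → ℝ} (h0 : ∀ ω, 0 ≤ μ ω) (Z : Ω → T)
    (X : Ω → S) : ent (cprod μ Z) (fun p => X p.2) = ent μ X := by
  rw [ent_eq, ent_eq, ← cprod_snd h0 Z]
  simp only [cprod_pmass_snd h0]

lemma cprod_ent_pair {Ω S T : Type*} [Fintype Ω] {μ : Ω → ℝ} (h0 : ∀ ω, 0 ≤ μ ω)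
    (φ : S → T) (X : Ω → S) (Z : Ω → T) (hZ : ∀ ω, Z ω = φ (X ω)) :
    ent (cprod μ Z) (fun p => (X p.1, X p.2)) = 2 * ent μ X - ent μ Z := by
  have e1 := cprod_fst h0 Z (fun ω => Real.log (pmass μ X (X ω)))
  have e2 := cprod_snd h0 Z (fun ω => Real.log (pmass μ X (X ω)))
  have e3 := cprod_fst h0 Z (fun ω => Real.log (pmass μ Z (Z ω)))
  have main : ∑ p, cprod μ Z p *
        Real.log (pmass (cprod μ Z) (fun p => (X p.1, X p.2)) (X p.1, X p.2))
      = ∑ p, (cprod μ Z p * Real.log (pmass μ X (X p.1)) + cprod μ Z p *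
        Real.log (pmass μ X (X p.2)) - cprod μ Z p * Real.log (pmass μ Z (Z p.1))) := by
    refine Finset.sum_congr rfl fun q _ => ?_
    by_cases hq : cprod μ Z q = 0
    · simp [hq]
    have hzz : Z q.1 = Z q.2 := by
      by_contra hne
      exact hq (by simp [cprod, hne])
    have hm1 : μ q.1 ≠ 0 := fun h => hq (by simp [cprod, h])
    have hm2 : μ q.2 ≠ 0 := fun h => hq (by simp [cprod, h])
    have b1 := lt_of_lt_of_le (lt_of_le_of_ne (h0 _) hm1.symm) (le_pmass h0 X q.1)
    have b2 := lt_of_lt_of_le (lt_of_le_of_ne (h0 _) hm2.symm) (le_pmass h0 X q.2)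
    have b3 := lt_of_lt_of_le (lt_of_le_of_ne (h0 _) hm1.symm) (le_pmass h0 Z q.1)
    have hp : pmass (cprod μ Z) (fun p => (X p.1, X p.2)) (X q.1, X q.2)
        = pmass μ X (X q.1) * pmass μ X (X q.2) / pmass μ Z (Z q.1) := by
      rw [pmass, pmass, pmass, Finset.sum_mul_sum, Fintype.sum_prod_type, Finset.sum_div]
      refine Finset.sum_congr rfl fun a _ => ?_
      rw [Finset.sum_div]
      refine Finset.sum_congr rfl fun b _ => ?_
      by_cases h1 : X a = X q.1
      · by_cases h2 : X b = X q.2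
        · have ha : Z a = Z q.1 := by rw [hZ, hZ, h1]
          have hb : Z b = Z q.1 := by rw [hzz, hZ, hZ, h2]
          simp [cprod, h1, h2, ha, hb]
        · simp [h2]
      · simp [h1]
    rw [hp, Real.log_div (by positivity) b3.ne', Real.log_mul b1.ne' b2.ne']
    ring
  rw [ent_eq, main, Finset.sum_sub_distrib, Finset.sum_add_distrib, e1, e2, e3, ent_eq, ent_eq]
  ring

lemma condMeas_cprod {Ω T : Type*} [Fintype Ω] {μ : Ω → ℝ} (h0 : ∀ ω, 0 ≤ μ ω) (Z : Ω → T) (z : T) :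
    (fun p : Ω × Ω => condMeas μ Z z p.1 * condMeas μ Z z p.2)
      = condMeas (cprod μ Z) (fun p => Z p.1) z := by
  funext p
  simp only [condMeas, cprod_pmass_fst h0, cprod]
  by_cases h1 : Z p.1 = z
  · by_cases h2 : Z p.2 = z
    · simp [h1, h2]; ring
    · simp [h1, h2, Ne.symm h2]
  · simp [h1]

/-- **Entropic Balog–Szemerédi–Gowers (Lemma A.2).** For a jointly distributed pair
`(A, B)` with values in `G × G` and `Z := A + B`:
`Σ_z P(Z = z) d[(A | Z = z); (B | Z = z)] ≤ 3 I[A : B] + 2 H[Z] - H[A] - H[B]`. -/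
theorem entropic_bsg {G Ω : Type*} [AddCommGroup G] [Fintype Ω]
    (μ : Ω → ℝ) (hμ : IsProb μ) (A B : Ω → G) :
    ∑ z ∈ Finset.univ.image (fun ω => A ω + B ω),
        pmass μ (fun ω => A ω + B ω) z *
          rdist (condMeas μ (fun ω => A ω + B ω) z) A
            (condMeas μ (fun ω => A ω + B ω) z) B
      ≤ 3 * mutualInfo μ A B + 2 * ent μ (fun ω => A ω + B ω) - ent μ A - ent μ B := by
  obtain ⟨h0, h1⟩ := id hμ
  set Z : Ω → G := fun ω => A ω + B ω with hZ
  have hν := cprod_prob hμ Z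
  set ν := cprod μ Z with hνd
  have hsupp : ∀ p, ν p ≠ 0 → A p.1 + B p.1 = A p.2 + B p.2 := by
    intro p hp
    by_contra hne
    exact hp (by simp [hνd, cprod, hZ, hne])
  set D : Ω × Ω → G := fun p => A p.1 - B p.2 with hD
  have c1 := chain μ h0 A Z
  have c2 := chain μ h0 B Z
  have c3 := chain ν hν.1 D (fun p => Z p.1)
  have s1 := subadd ν hν D (fun p => Z p.1)
  have e1 : ent μ (fun ω => (A ω, Z ω)) = ent μ (fun ω => (A ω, B ω)) :=
    ent_congr _ _ _ (by intro ω ω' _ _; simp only [hZ, Prod.mk.injEq]; grind)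
  have e2 : ent μ (fun ω => (B ω, Z ω)) = ent μ (fun ω => (A ω, B ω)) :=
    ent_congr _ _ _ (by intro ω ω' _ _; simp only [hZ, Prod.mk.injEq]; grind)
  have s2 := submod ν hν (fun p => A p.1) (fun p => B p.1) D
  have e3 : ent ν (fun p => (A p.1, B p.1, D p))
      = ent ν (fun p => ((A p.1, B p.1), (A p.2, B p.2))) :=
    ent_congr _ _ _ (by
      intro p q hp hq
      have := hsupp p hp
      have := hsupp q hq
      simp only [hD, Prod.mk.injEq]; grind)
  have e4 : ent ν (fun p => (A p.1, D p)) = ent ν (fun p => (A p.1, B p.2)) :=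
    ent_congr _ _ _ (by
      intro p q hp hq
      simp only [hD, Prod.mk.injEq]; grind)
  have e5 : ent ν (fun p => (B p.1, D p)) = ent ν (fun p => (B p.1, A p.2)) :=
    ent_congr _ _ _ (by
      intro p q hp hq
      have := hsupp p hp
      have := hsupp q hq
      simp only [hD, Prod.mk.injEq]; grind)
  have e6 : ent ν (fun p => ((A p.1, B p.1), (A p.2, B p.2)))
      = 2 * ent μ (fun ω => (A ω, B ω)) - ent μ Z :=
    cprod_ent_pair h0 (fun s : G × G => s.1 + s.2) (fun ω => (A ω, B ω)) Z (fun _ => rfl)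
  have s3 := subadd ν hν (fun p => A p.1) (fun p => B p.2)
  have s4 := subadd ν hν (fun p => B p.1) (fun p => A p.2)
  rw [cprod_ent_fst h0 Z A, cprod_ent_snd h0 Z B] at s3
  rw [cprod_ent_fst h0 Z B, cprod_ent_snd h0 Z A] at s4
  have him : Finset.univ.image (fun p : Ω × Ω => Z p.1) = Finset.univ.image Z := by
    ext z
    simp only [Finset.mem_image, Finset.mem_univ, true_and]
    exact ⟨fun ⟨p, hp⟩ => ⟨p.1, hp⟩, fun ⟨w, hw⟩ => ⟨(w, w), hw⟩⟩
  have expand : ∑ z ∈ Finset.univ.image Z, pmass μ Z z *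
        rdist (condMeas μ Z z) A (condMeas μ Z z) B
      = (ent ν (fun p => (D p, Z p.1)) - ent ν (fun p => Z p.1))
        - (ent μ (fun ω => (A ω, Z ω)) - ent μ Z) / 2
        - (ent μ (fun ω => (B ω, Z ω)) - ent μ Z) / 2 := by
    rw [← c1, ← c2, ← c3, him, Finset.sum_div, Finset.sum_div, ← Finset.sum_sub_distrib,
      ← Finset.sum_sub_distrib]
    refine Finset.sum_congr rfl fun z _ => ?_
    rw [rdist, condMeas_cprod h0 Z z, hνd, cprod_pmass_fst h0]
    ring
  rw [expand]
  unfold mutualInfo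
  linarith

end
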